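/- arXiv:2604.07349 — 2 statements merged into one kernel-verified Lean document; each statement's English description precedes it below -/
import Mathlib

section
/- Let ι have decidable equality, let S = Π i : ι, X i be a product state space, and let (A, U) be a decision problem on S. If I ⊆ ι is a minimal sufficient coordinate set (I is sufficient and no proper subset of I is sufficient), then for every coordinate i : ι, i ∈ I if and only if i is relevant. Consequently, any two minimal sufficient coordinate sets are equal. -/
/-- The optimizer map of a decision problem with utility `U`. -/
def Opt {A S : Type*} (U : A → S → ℝ) (s : S) : Set A :=
  {a | ∀ b, U b s ≤ U a s}

/-- A coordinate set `I` is sufficient if agreement on `I` forces equal optimizer sets. -/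
def Sufficient {ι : Type*} {X : ι → Type*} {A : Type*}
    (U : A → (∀ i, X i) → ℝ) (I : Set ι) : Prop :=
  ∀ s s' : ∀ i, X i, (∀ i ∈ I, s i = s' i) → Opt U s = Opt U s'

/-- A coordinate `i` is relevant if erasing it destroys sufficiency. -/
def Relevant {ι : Type*} {X : ι → Type*} {A : Type*}
    (U : A → (∀ i, X i) → ℝ) (i : ι) : Prop :=
  ¬ Sufficient U (Set.univ \ {i})

theorem Sufficient.mono {ι : Type*} {X : ι → Type*} {A : Type*}
    {U : A → (∀ i, X i) → ℝ} {I J : Set ι} (hI : Sufficient U I) (hIJ : I ⊆ J) :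
    Sufficient U J :=
  fun s s' h => hI s s' fun i hi => h i (hIJ hi)

open Classical in
theorem Sufficient.inter {ι : Type*} {X : ι → Type*} {A : Type*}
    {U : A → (∀ i, X i) → ℝ} {I J : Set ι} (hI : Sufficient U I) (hJ : Sufficient U J) :
    Sufficient U (I ∩ J) := by
  intro s s' h
  let t : ∀ i, X i := fun i => if i ∈ I then s i else s' i
  refine (hI s t fun i hi => by simp [t, hi]).trans (hJ t s' fun i hi => ?_)
  by_cases hiI : i ∈ I
  · simpa [t, hiI] using h i ⟨hiI, hi⟩
  · simp [t, hiI]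

/-- The coordinates of a minimal sufficient set are exactly the relevant ones. -/
theorem mem_iff_relevant_of_minimal_sufficient {ι : Type*} {X : ι → Type*} {A : Type*}
    {U : A → (∀ i, X i) → ℝ} {I : Set ι}
    (hI : Sufficient U I ∧ ∀ J : Set ι, J ⊂ I → ¬ Sufficient U J) (i : ι) :
    i ∈ I ↔ Relevant U i := by
  constructor
  · intro hi h
    refine hI.2 _ ⟨Set.inter_subset_left, fun hsub => ?_⟩ (hI.1.inter h)
    exact (hsub hi).2.2 rfl
  · intro h
    by_contra hi
    refine h (hI.1.mono fun j hj => ⟨trivial, ?_⟩)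
    rintro rfl
    exact hi hj

/-- Minimal sufficient sets are exactly the relevant-coordinate set, hence unique. -/
theorem minimal_sufficient_canonical {ι : Type*} [DecidableEq ι] {X : ι → Type*} {A : Type*}
    (U : A → (∀ i, X i) → ℝ) (I : Set ι)
    (hI : Sufficient U I ∧ ∀ J : Set ι, J ⊂ I → ¬ Sufficient U J) :
    (∀ i : ι, i ∈ I ↔ Relevant U i) ∧
    (∀ I' : Set ι, (Sufficient U I' ∧ ∀ J : Set ι, J ⊂ I' → ¬ Sufficient U J) → I' = I) := by
  refine ⟨mem_iff_relevant_of_minimal_sufficient hI, fun I' hI' => Set.ext fun i => ?_⟩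
  rw [mem_iff_relevant_of_minimal_sufficient hI', mem_iff_relevant_of_minimal_sufficient hI]
end

section
/- For every ε > 0, there exist two decision problems (A, U) and (A, U') on the same one-coordinate Boolean product state space S = Unit → Bool (with the same action type A having at least two actions) such that |U(a, s) − U'(a, s)| ≤ ε for all actions a and states s, yet the unique coordinate is relevant for one problem and irrelevant for the other. Likewise, for every ε > 0 there exist two uniformly ε-close decision problems on that state space such that the empty coordinate set is sufficient for one and not sufficient for the other. -/
/-- The utility on a Boolean coordinate that pays `ε` for matching the state. -/
def matchUtility (ε : ℝ) (a : Bool) (s : Unit → Bool) : ℝ :=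
  if a = s () then ε else 0

theorem abs_matchUtility_le {ε : ℝ} (hε : 0 ≤ ε) (a : Bool) (s : Unit → Bool) :
    |matchUtility ε a s| ≤ ε := by
  unfold matchUtility
  split_ifs <;> simp [abs_of_nonneg hε, hε]

theorem not_sufficient_empty_matchUtility {ε : ℝ} (hε : 0 < ε) :
    ¬ Sufficient (matchUtility ε) (∅ : Set Unit) := by
  intro h
  have hopt := h (fun _ => true) (fun _ => false) (by simp)
  have hmem : true ∈ Opt (matchUtility ε) (fun _ => true) := by
    intro b
    cases b <;> simp [matchUtility, hε.le]
  rw [hopt] at hmem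
  have hle := hmem false
  simp only [matchUtility, reduceIte, Bool.true_eq_false] at hle
  exact hε.not_ge hle

theorem sufficient_zero {ι : Type*} {X : ι → Type*} {A : Type*} (I : Set ι) :
    Sufficient (fun (_ : A) (_ : ∀ i, X i) => (0 : ℝ)) I :=
  fun _ _ _ => rfl

theorem relevant_unit_iff {A : Type*} (U : A → (Unit → Bool) → ℝ) :
    Relevant U () ↔ ¬ Sufficient U (∅ : Set Unit) := by
  have hset : (Set.univ \ {()} : Set Unit) = ∅ := by
    ext
    simp
  rw [Relevant, hset]

/-- Arbitrarily small uniform perturbations can flip relevance and can flip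
sufficiency of the empty coordinate set. -/
theorem small_perturbations_flip (ε : ℝ) (hε : 0 < ε) :
    (∃ (A : Type) (U U' : A → (Unit → Bool) → ℝ), Nontrivial A ∧
      (∀ (a : A) (s : Unit → Bool), |U a s - U' a s| ≤ ε) ∧
      Relevant U () ∧ ¬ Relevant U' ()) ∧
    (∃ (A : Type) (U U' : A → (Unit → Bool) → ℝ), Nontrivial A ∧
      (∀ (a : A) (s : Unit → Bool), |U a s - U' a s| ≤ ε) ∧
      Sufficient U (∅ : Set Unit) ∧ ¬ Sufficient U' (∅ : Set Unit)) := by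
  have hns := not_sufficient_empty_matchUtility hε
  refine ⟨⟨Bool, matchUtility ε, fun _ _ => 0, inferInstance, fun a s => ?_,
      (relevant_unit_iff _).2 hns, fun h => h (sufficient_zero _)⟩,
    ⟨Bool, fun _ _ => 0, matchUtility ε, inferInstance, fun a s => ?_, sufficient_zero _, hns⟩⟩
  · simpa using abs_matchUtility_le hε.le a s
  · simpa using abs_matchUtility_le hε.le a s
end
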